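/- arXiv:1906.10866 — 4 statements merged into one kernel-verified Lean document; each statement's English description precedes it below -/
import Mathlib

section
/- Suppose in addition that Ω is continuously differentiable, so that K is differentiable on ℂ∖{0}; denote by DK(y) its (total) derivative at y. Let φ : [0,∞) → [0,1] be a smooth function with φ(t) = 0 for t ∉ [1/4, 4] and φ(t) = 1 for t ∈ [1, 2]. Let μ be a locally finite Borel measure on ℂ, let e ∈ 𝕊, let e_z ∈ 𝕊 satisfy ⟨e_z, e⟩ = 0, and for r > 0 define A₂(v) := r⁻² ∫_ℂ (DK(−y)·v) φ(|y|²/r²) dμ(y) for v ∈ ℂ. Then there is a constant c > 0 depending only on δ_Ω such that, for ν a unit normal to the line ℝΩ(e) (i.e. ν = ±iΩ(e)), one has |⟨A₂(e_z), ν⟩| ≥ c · r⁻² · μ({y ∈ ℂ : r ≤ |y| ≤ √2·r}) for every r > 0. -/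
open MeasureTheory Metric Complex Filter Set
open scoped Topology ENNReal NNReal

noncomputable section

/-- The real inner product on `ℂ ≅ ℝ²`. -/
def rinner (u v : ℂ) : ℝ := u.re * v.re + u.im * v.im

/-- The geodesic distance on the unit circle `𝕊 ⊂ ℂ`. -/
def dS (u v : ℂ) : ℝ := Real.arccos (rinner u v)

/-- The kernel `K(x) = |x| Ω(x/|x|)` (with `K 0 = 0`). -/
def Kmap (Ω : ℂ → ℂ) (x : ℂ) : ℂ := (‖x‖ : ℂ) * Ω (x / (‖x‖ : ℂ))

/-- The support of a measure on `ℂ`. -/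
def spt (μ : Measure ℂ) : Set ℂ := {x : ℂ | ∀ r : ℝ, 0 < r → 0 < μ (ball x r)}

/-- Ahlfors 1-regularity with constant `C₀`. -/
def Ahlfors1 (μ : Measure ℂ) (C₀ : ℝ) : Prop :=
  ∀ x ∈ spt μ, ∀ r : ℝ, 0 < r →
    ENNReal.ofReal (C₀⁻¹ * r) ≤ μ (ball x r) ∧ μ (ball x r) ≤ ENNReal.ofReal (C₀ * r)

/-- `Ω`-symmetry of a measure. -/
def OmegaSym (Ω : ℂ → ℂ) (μ : Measure ℂ) : Prop :=
  ∀ x ∈ spt μ, ∀ r : ℝ, 0 < r → (∫ y in ball x r, Kmap Ω (x - y) ∂μ) = 0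

/-- `Ω` maps the unit circle to itself. -/
def MapsCircle (Ω : ℂ → ℂ) : Prop := ∀ u : ℂ, ‖u‖ = 1 → ‖Ω u‖ = 1

/-- `Ω` is odd on the unit circle. -/
def OddOnCircle (Ω : ℂ → ℂ) : Prop := ∀ u : ℂ, ‖u‖ = 1 → Ω (-u) = -(Ω u)

/-- `Ω` is bi-Lipschitz with constant `1 + δ` on the circle, w.r.t. geodesic distance. -/
def BiLipOnCircle (Ω : ℂ → ℂ) (δ : ℝ) : Prop :=
  ∀ u v : ℂ, ‖u‖ = 1 → ‖v‖ = 1 →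
    (1 + δ)⁻¹ * dS u v ≤ dS (Ω u) (Ω v) ∧ dS (Ω u) (Ω v) ≤ (1 + δ) * dS u v

/-- `Ω` is `C^k` as a circle map: it has a `C^k` lift `ω`. -/
def CircleCk (Ω : ℂ → ℂ) (k : ℕ) : Prop :=
  ∃ ω : ℝ → ℝ, ContDiff ℝ k ω ∧
    ∀ t : ℝ, Ω (Complex.exp ((t : ℂ) * Complex.I)) = Complex.exp ((ω t : ℂ) * Complex.I)

/-- Affine lines in `ℂ`. -/
def IsLine (L : Set ℂ) : Prop :=
  ∃ a b : ℂ, b ≠ 0 ∧ L = {z : ℂ | ∃ t : ℝ, z = a + t • b}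

lemma rinner_exp (a b : ℝ) :
    rinner (Complex.exp ((a : ℂ) * Complex.I)) (Complex.exp ((b : ℂ) * Complex.I))
      = Real.cos (a - b) := by
  simp only [rinner, Complex.exp_ofReal_mul_I_re, Complex.exp_ofReal_mul_I_im, Real.cos_sub]

lemma dS_exp (a b : ℝ) (h : |a - b| ≤ Real.pi) :
    dS (Complex.exp ((a : ℂ) * Complex.I)) (Complex.exp ((b : ℂ) * Complex.I)) = |a - b| := by
  rw [dS, rinner_exp, ← Real.cos_abs, Real.arccos_cos (abs_nonneg _) h]

lemma deriv_bounds (δ : ℝ) (hδ0 : 0 ≤ δ) (Ω : ℂ → ℂ) (hb : BiLipOnCircle Ω δ)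
    (ω : ℝ → ℝ) (hω : Differentiable ℝ ω)
    (hΩ : ∀ t : ℝ, Ω (Complex.exp ((t : ℂ) * Complex.I)) = Complex.exp ((ω t : ℂ) * Complex.I))
    (t : ℝ) : (1 + δ)⁻¹ ≤ |deriv ω t| ∧ |deriv ω t| ≤ 1 + δ := by
  have h1 : Tendsto (fun x => |slope ω t x|) (𝓝[≠] t) (𝓝 |deriv ω t|) :=
    (hasDerivAt_iff_tendsto_slope.1 (hω t).hasDerivAt).abs
  have e1 : ∀ᶠ x in 𝓝[≠] t, |x - t| < Real.pi := by
    have : ContinuousAt (fun x : ℝ => |x - t|) t := by fun_prop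
    exact (this.eventually_lt continuousAt_const (by simpa using Real.pi_pos)).filter_mono
      nhdsWithin_le_nhds
  have e2 : ∀ᶠ x in 𝓝[≠] t, |ω x - ω t| < Real.pi := by
    have : ContinuousAt (fun x : ℝ => |ω x - ω t|) t :=
      ((hω t).continuousAt.sub continuousAt_const).abs
    exact (this.eventually_lt continuousAt_const (by simpa using Real.pi_pos)).filter_mono
      nhdsWithin_le_nhds
  have e3 : ∀ᶠ x in 𝓝[≠] t, (1 + δ)⁻¹ ≤ |slope ω t x| ∧ |slope ω t x| ≤ 1 + δ := by
    filter_upwards [e1, e2, self_mem_nhdsWithin] with x h1 h2 h3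
    have hne : x - t ≠ 0 := sub_ne_zero.2 h3
    have hp : 0 < |x - t| := abs_pos.2 hne
    have := hb _ _ (Complex.norm_exp_ofReal_mul_I x) (Complex.norm_exp_ofReal_mul_I t)
    rw [hΩ, hΩ, dS_exp _ _ h1.le, dS_exp _ _ h2.le] at this
    rw [slope_def_field, abs_div, le_div_iff₀ hp, div_le_iff₀ hp]
    exact this
  exact ⟨ge_of_tendsto h1 (e3.mono fun _ h => h.1), le_of_tendsto h1 (e3.mono fun _ h => h.2)⟩

lemma sign_bounds (δ : ℝ) (hδ0 : 0 ≤ δ) (hδ1 : δ ≤ 1 / 20) (ω : ℝ → ℝ) (hc : Continuous (deriv ω))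
    (h : ∀ t, (1 + δ)⁻¹ ≤ |deriv ω t| ∧ |deriv ω t| ≤ 1 + δ) :
    ∃ σ : ℝ, (σ = 1 ∨ σ = -1) ∧ ∀ t, |σ * deriv ω t - 1| ≤ 1 / 20 := by
  have hl : (20 / 21 : ℝ) ≤ (1 + δ)⁻¹ := by
    rw [le_inv_comm₀ (by norm_num) (by linarith)]; linarith
  have hne : ∀ t, deriv ω t ≠ 0 := by
    intro t h0
    have := (h t).1
    rw [h0, abs_zero] at this
    linarith
  by_cases hp : 0 < deriv ω 0
  · refine ⟨1, Or.inl rfl, fun t => ?_⟩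
    have ht : 0 < deriv ω t := by
      by_contra hn
      obtain ⟨x, hx⟩ := mem_range_of_exists_le_of_exists_ge hc ⟨t, not_lt.1 hn⟩ ⟨0, hp.le⟩
      exact hne x hx
    have := h t
    rw [abs_of_pos ht] at this
    rw [abs_le]; constructor <;> linarith
  · refine ⟨-1, Or.inr rfl, fun t => ?_⟩
    have ht : deriv ω t < 0 := by
      by_contra hn
      obtain ⟨x, hx⟩ := mem_range_of_exists_le_of_exists_ge hc ⟨0, not_lt.1 hp⟩ ⟨t, not_lt.1 hn⟩
      exact hne x hx
    have := h t
    rw [abs_of_neg ht] at this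
    rw [abs_le]; constructor <;> linarith

lemma trig_bound (ω : ℝ → ℝ) (hω : Differentiable ℝ ω) (σ : ℝ) (hσ : σ = 1 ∨ σ = -1)
    (h : ∀ t, |σ * deriv ω t - 1| ≤ 1 / 20) (β s : ℝ) (hs : |s| ≤ Real.pi) :
    1 / 2 ≤ σ * (Real.sin s * Real.sin (ω (β + s) - ω β) +
      deriv ω (β + s) * Real.cos s * Real.cos (ω (β + s) - ω β)) := by
  have hd : ∀ x, HasDerivAt (fun x => σ * ω x - x) (σ * deriv ω x - 1) x := fun x =>
    ((hω x).hasDerivAt.const_mul σ).sub (hasDerivAt_id x)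
  have hm := Convex.norm_image_sub_le_of_norm_hasDerivWithin_le (s := Set.univ)
    (fun x _ => (hd x).hasDerivWithinAt) (fun x _ => h x) convex_univ
    (Set.mem_univ β) (Set.mem_univ (β + s))
  simp only [Real.norm_eq_abs, add_sub_cancel_left] at hm
  set Δ := ω (β + s) - ω β with hΔ
  have hm' : |σ * Δ - s| ≤ 16 / 100 := by
    have : σ * ω (β + s) - (β + s) - (σ * ω β - β) = σ * Δ - s := by rw [hΔ]; ring
    rw [this] at hm
    have := Real.pi_lt_d2
    linarith
  have hcos : 98 / 100 ≤ Real.cos (σ * Δ - s) := by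
    have h1 := Real.one_sub_sq_div_two_le_cos (x := σ * Δ - s)
    have h2 : (σ * Δ - s) ^ 2 ≤ (16 / 100) ^ 2 := sq_le_sq' (abs_le.1 hm').1 (abs_le.1 hm').2
    linarith
  have key : σ * (Real.sin s * Real.sin Δ + deriv ω (β + s) * Real.cos s * Real.cos Δ)
      = Real.cos (σ * Δ - s) + (σ * deriv ω (β + s) - 1) * (Real.cos s * Real.cos Δ) := by
    rcases hσ with rfl | rfl
    · rw [one_mul, one_mul, Real.cos_sub Δ s]; ring
    · rw [neg_one_mul Δ, Real.cos_sub (-Δ) s, Real.cos_neg, Real.sin_neg]; ring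
  have hsmall : |(σ * deriv ω (β + s) - 1) * (Real.cos s * Real.cos Δ)| ≤ 1 / 20 := by
    rw [abs_mul, abs_mul]
    have a := Real.abs_cos_le_one s
    have b := Real.abs_cos_le_one Δ
    have c := h (β + s)
    have : |Real.cos s| * |Real.cos Δ| ≤ 1 := mul_le_one₀ a (abs_nonneg _) b
    calc _ ≤ (1 / 20 : ℝ) * 1 := mul_le_mul c this (by positivity) (by norm_num)
      _ = _ := by norm_num
  rw [key]
  have := (abs_le.1 hsmall).1
  linarith

lemma fderiv_Kmap (Ω : ℂ → ℂ) (ω : ℝ → ℝ) (hω : Differentiable ℝ ω)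
    (hΩ : ∀ t : ℝ, Ω (Complex.exp ((t : ℂ) * Complex.I)) = Complex.exp ((ω t : ℂ) * Complex.I))
    (ρ θ : ℝ) (hρ : 0 < ρ) (v : ℂ) :
    fderiv ℝ (Kmap Ω) (ρ * Complex.exp ((θ : ℂ) * Complex.I)) v =
      ((v * Complex.exp (-(θ : ℂ) * Complex.I)).re
        + (deriv ω θ * (v * Complex.exp (-(θ : ℂ) * Complex.I)).im : ℝ) * Complex.I)
       * Complex.exp ((ω θ : ℂ) * Complex.I) := by
  set E := Complex.exp (-(θ : ℂ) * Complex.I) with hE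
  set F := Complex.exp ((θ : ℂ) * Complex.I) with hF
  have hEF : F * E = 1 := by rw [hE, hF, ← Complex.exp_add]; simp
  have hρ' : (ρ : ℂ) ≠ 0 := by exact_mod_cast hρ.ne'
  have hF0 : F ≠ 0 := Complex.exp_ne_zero _
  have hE0 : E ≠ 0 := Complex.exp_ne_zero _
  set x := (ρ : ℂ) * F with hx
  have hx0 : x ≠ 0 := mul_ne_zero hρ' hF0
  have hxE : x * E = ρ := by rw [hx, mul_assoc, hEF, mul_one]
  let L : ℂ → ℂ := fun z => Complex.log (z * E)
  have hLx : L x = (Real.log ρ : ℝ) := by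
    simp only [L, hxE]; rw [Complex.ofReal_log hρ.le]
  have hL : HasFDerivAt L ((E / ρ) • (1 : ℂ →L[ℂ] ℂ)) x := by
    have h1 : HasDerivAt L (E / (x * E)) x := by
      have := ((hasDerivAt_id x).mul_const E).clog (by simp [hxE, hρ])
      simpa using this
    rw [hxE] at h1
    have h2 : (E / ρ) • (1 : ℂ →L[ℂ] ℂ) = ContinuousLinearMap.toSpanSingleton ℂ (E / (ρ : ℂ)) := by
      ext; simp
    rw [h2]; exact h1.hasFDerivAt
  have hLR : HasFDerivAt L (((E / ρ) • (1 : ℂ →L[ℂ] ℂ)).restrictScalars ℝ) x :=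
    hL.restrictScalars ℝ
  have hre := Complex.reCLM.hasFDerivAt.comp x hLR
  have him := Complex.imCLM.hasFDerivAt.comp x hLR
  have hω1 : HasDerivAt ω (deriv ω θ) (θ + (Complex.imCLM (L x))) := by
    have : θ + (Complex.imCLM (L x)) = θ := by simp [hLx]
    rw [this]; exact (hω θ).hasDerivAt
  have hω2 := hω1.comp_hasFDerivAt x (him.const_add θ)
  have h3 := (((Complex.ofRealCLM.hasFDerivAt.comp x hre).add
    ((Complex.ofRealCLM.hasFDerivAt.comp x hω2).mul_const Complex.I))).cexp
  have hev : (Kmap Ω) =ᶠ[𝓝 x]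
      (fun z => Complex.exp (((L z).re : ℝ) + (ω (θ + (L z).im) : ℝ) * Complex.I)) := by
    filter_upwards [isOpen_ne.mem_nhds hx0] with z hz
    have hz : z ≠ 0 := hz
    have hzE : z * E ≠ 0 := mul_ne_zero hz hE0
    have hn : ‖z * E‖ = ‖z‖ := by
      have : ‖E‖ = 1 := by
        rw [hE]; simpa using Complex.norm_exp_ofReal_mul_I (-θ)
      rw [norm_mul, this, mul_one]
    have hre : Complex.exp (((L z).re : ℝ)) = ‖z‖ := by
      simp only [L, Complex.log_re, hn]
      rw [← Complex.ofReal_exp, Real.exp_log (norm_pos_iff.2 hz)]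
    have hz' : z / (‖z‖ : ℂ) = Complex.exp (((θ + (L z).im : ℝ) : ℂ) * Complex.I) := by
      have h5 : (‖z‖ : ℂ) * Complex.exp ((((L z).im : ℝ) : ℂ) * Complex.I) = z * E := by
        rw [← hre, ← Complex.exp_add, Complex.re_add_im]
        exact Complex.exp_log hzE
      have hnz : (‖z‖ : ℂ) ≠ 0 := by exact_mod_cast (norm_pos_iff.2 hz).ne'
      rw [div_eq_iff hnz, Complex.ofReal_add, add_mul, Complex.exp_add, mul_assoc, mul_comm _ (‖z‖ : ℂ),
        h5, ← hF]
      linear_combination (-z) * hEF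
    rw [Complex.exp_add, hre, ← hΩ, ← hz', Kmap]
  have h4 := (h3.congr_of_eventuallyEq hev).fderiv
  rw [h4]
  have hexp : Complex.exp (((L x).re : ℝ) + (ω (θ + (L x).im) : ℝ) * Complex.I)
      = ρ * Complex.exp ((ω θ : ℂ) * Complex.I) := by
    rw [Complex.exp_add, hLx]
    simp only [Complex.ofReal_re, Complex.ofReal_im, add_zero]
    rw [← Complex.ofReal_exp, Real.exp_log hρ]
  have hv1 : (E / ρ * v).re = (v * E).re / ρ := by
    rw [show E / ρ * v = (v * E) / ρ by ring, Complex.div_ofReal_re]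
  have hv2 : (E / ρ * v).im = (v * E).im / ρ := by
    rw [show E / ρ * v = (v * E) / ρ by ring, Complex.div_ofReal_im]
  simp only [Function.comp_apply, Complex.reCLM_apply, Complex.imCLM_apply, Complex.ofRealCLM_apply,
    Pi.add_apply]
  rw [hexp]
  simp [hv1, hv2, -Complex.mul_re, -Complex.mul_im]
  field_simp

lemma pointwise (Ω : ℂ → ℂ) (ω : ℝ → ℝ) (hω : Differentiable ℝ ω)
    (hΩ : ∀ t : ℝ, Ω (Complex.exp ((t : ℂ) * Complex.I)) = Complex.exp ((ω t : ℂ) * Complex.I))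
    (σ : ℝ) (hσ : σ = 1 ∨ σ = -1) (h : ∀ t, |σ * deriv ω t - 1| ≤ 1 / 20)
    (β : ℝ) (x : ℂ) (hx : x ≠ 0) :
    1 / 2 ≤ σ * rinner (fderiv ℝ (Kmap Ω) x (Complex.I * Complex.exp ((β : ℂ) * Complex.I)))
      (Complex.I * Complex.exp ((ω β : ℂ) * Complex.I)) := by
  set s := Complex.arg (x * Complex.exp (-(β : ℂ) * Complex.I)) with hs
  have hxs : x = (‖x‖ : ℝ) * Complex.exp (((β + s : ℝ) : ℂ) * Complex.I) := by
    have h1 := Complex.norm_mul_exp_arg_mul_I (x * Complex.exp (-(β : ℂ) * Complex.I))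
    have hn : ‖x * Complex.exp (-(β : ℂ) * Complex.I)‖ = ‖x‖ := by
      have : ‖Complex.exp (-(β : ℂ) * Complex.I)‖ = 1 := by
        simpa using Complex.norm_exp_ofReal_mul_I (-β)
      rw [norm_mul, this, mul_one]
    rw [hn, ← hs] at h1
    have h2 : Complex.exp (-(β : ℂ) * Complex.I) * Complex.exp ((β : ℂ) * Complex.I) = 1 := by
      rw [← Complex.exp_add]; simp
    rw [Complex.ofReal_add, add_mul, Complex.exp_add]
    linear_combination (-x) * h2 - Complex.exp ((β : ℂ) * Complex.I) * h1
  have hsπ : |s| ≤ Real.pi := Complex.abs_arg_le_pi _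
  have hb := trig_bound ω hω σ hσ h β s hsπ
  rw [hxs, fderiv_Kmap Ω ω hω hΩ _ _ (norm_pos_iff.2 hx)]
  have hv : Complex.I * Complex.exp ((β : ℂ) * Complex.I) *
      Complex.exp (-((β + s : ℝ) : ℂ) * Complex.I) = Real.sin s + Real.cos s * Complex.I := by
    rw [mul_assoc, ← Complex.exp_add]
    have : (β : ℂ) * Complex.I + -((β + s : ℝ) : ℂ) * Complex.I = ((-s : ℝ) : ℂ) * Complex.I := by
      push_cast; ring
    rw [this]
    apply Complex.ext <;>
      simp [Complex.exp_ofReal_mul_I_re, Complex.exp_ofReal_mul_I_im, -Complex.ofReal_neg, -Complex.ofReal_sin, -Complex.ofReal_cos]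
  rw [hv]
  refine hb.trans (le_of_eq ?_)
  congr 1
  simp only [rinner, Complex.mul_re, Complex.mul_im, Complex.exp_ofReal_mul_I_re,
    Complex.exp_ofReal_mul_I_im, Complex.add_re, Complex.add_im, Complex.ofReal_re,
    Complex.ofReal_im, Complex.I_re, Complex.I_im, Real.cos_sub, Real.sin_sub]
  ring

lemma fderiv_bound (Ω : ℂ → ℂ) (ω : ℝ → ℝ) (hω : Differentiable ℝ ω)
    (hΩ : ∀ t : ℝ, Ω (Complex.exp ((t : ℂ) * Complex.I)) = Complex.exp ((ω t : ℂ) * Complex.I))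
    (h : ∀ t, |deriv ω t| ≤ 2) (x v : ℂ) (hx : x ≠ 0) (hv : ‖v‖ = 1) :
    ‖fderiv ℝ (Kmap Ω) x v‖ ≤ 3 := by
  have hxs : x = (‖x‖ : ℝ) * Complex.exp (((Complex.arg x : ℝ) : ℂ) * Complex.I) :=
    (Complex.norm_mul_exp_arg_mul_I x).symm
  rw [hxs, fderiv_Kmap Ω ω hω hΩ _ _ (norm_pos_iff.2 hx), norm_mul,
    Complex.norm_exp_ofReal_mul_I, mul_one]
  set w := v * Complex.exp (-(Complex.arg x : ℂ) * Complex.I) with hw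
  have hn : ‖w‖ = 1 := by
    have : ‖Complex.exp (-(Complex.arg x : ℂ) * Complex.I)‖ = 1 := by
      simpa using Complex.norm_exp_ofReal_mul_I (-(Complex.arg x))
    rw [hw, norm_mul, this, mul_one, hv]
  have h1 := Complex.abs_re_le_norm w
  have h2 := Complex.abs_im_le_norm w
  rw [hn] at h1 h2
  refine (norm_add_le _ _).trans ?_
  rw [norm_mul, Complex.norm_I, mul_one, Complex.norm_real, Complex.norm_real, Real.norm_eq_abs,
    Real.norm_eq_abs, abs_mul]
  have : |deriv ω (Complex.arg x)| * |w.im| ≤ 2 * 1 :=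
    mul_le_mul (h _) h2 (abs_nonneg _) (by norm_num)
  linarith

lemma rinner_smul_left' (a : ℝ) (z ν : ℂ) : rinner (a • z) ν = a * rinner z ν := by
  simp [rinner]; ring

lemma rinner_CLM (ν : ℂ) : ∃ l : ℂ →L[ℝ] ℝ, ∀ z, l z = rinner z ν := by
  refine ⟨ν.re • Complex.reCLM + ν.im • Complex.imCLM, fun z => ?_⟩
  simp [rinner]; ring

lemma integral_bound (μ : Measure ℂ) [IsLocallyFiniteMeasure μ] (φ : ℝ → ℝ) (hφc : Continuous φ)
    (hφ : ∀ t : ℝ, 0 ≤ φ t ∧ φ t ≤ 1) (hφ0 : ∀ t : ℝ, t < 1 / 4 ∨ 4 < t → φ t = 0)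
    (hφ1 : ∀ t : ℝ, 1 ≤ t → t ≤ 2 → φ t = 1) (r : ℝ) (hr : 0 < r)
    (G : ℂ → ℂ) (hG : Measurable G) (hGb : ∀ y, y ≠ 0 → ‖G y‖ ≤ 3) (ν : ℂ) (σ : ℝ)
    (hσ : σ = 1 ∨ σ = -1)
    (hGl : ∀ y, y ≠ 0 → 1 / 2 ≤ σ * rinner (G y) ν) :
    1 / 2 * (r ^ 2)⁻¹ * (μ {y : ℂ | r ≤ ‖y‖ ∧ ‖y‖ ≤ Real.sqrt 2 * r}).toReal ≤
          |rinner ((r ^ 2)⁻¹ • ∫ y, φ (‖y‖ ^ 2 / r ^ 2) • G y ∂μ) ν| := by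
  have hr2 : 0 < r ^ 2 := by positivity
  set A := {y : ℂ | r ≤ ‖y‖ ∧ ‖y‖ ≤ Real.sqrt 2 * r} with hA
  have hAm : MeasurableSet A := by
    apply IsClosed.measurableSet
    exact (isClosed_le continuous_const continuous_norm).inter
      (isClosed_le continuous_norm continuous_const)
  have hzero : ∀ y : ℂ, y ∉ closedBall (0 : ℂ) (2 * r) → φ (‖y‖ ^ 2 / r ^ 2) = 0 := by
    intro y hy
    apply hφ0; right
    rw [mem_closedBall_zero_iff, not_le] at hy
    rw [lt_div_iff₀ hr2]
    nlinarith
  have hzero0 : φ (‖(0 : ℂ)‖ ^ 2 / r ^ 2) = 0 := hφ0 _ (by left; simp)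
  have hAfin : μ A < ⊤ := by
    refine lt_of_le_of_lt (measure_mono (t := closedBall (0 : ℂ) (2 * r)) ?_)
      (isCompact_closedBall _ _).measure_lt_top
    intro y hy
    rw [mem_closedBall_zero_iff]
    refine hy.2.trans (mul_le_mul_of_nonneg_right ?_ hr.le)
    rw [Real.sqrt_le_left (by norm_num)]; norm_num
  have hFm : Measurable (fun y : ℂ => φ (‖y‖ ^ 2 / r ^ 2) • G y) := by
    exact (by fun_prop : Continuous fun y : ℂ => φ (‖y‖ ^ 2 / r ^ 2)).measurable.smul hG
  have hint : Integrable (fun y : ℂ => φ (‖y‖ ^ 2 / r ^ 2) • G y) μ := by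
    rw [← integrableOn_iff_integrable_of_support_subset (s := closedBall (0 : ℂ) (2 * r))]
    · apply Measure.integrableOn_of_bounded (M := 3)
        (isCompact_closedBall _ _).measure_lt_top.ne hFm.aestronglyMeasurable
      refine Eventually.of_forall fun y => ?_
      by_cases hy : y = 0
      · rw [hy, hzero0]; simp
      · rw [norm_smul, Real.norm_eq_abs, abs_of_nonneg (hφ _).1]
        nlinarith [hφ (‖y‖ ^ 2 / r ^ 2), hGb y hy, norm_nonneg (G y)]
    · intro y hy
      by_contra hn
      exact hy (by simp [hzero y hn])
  obtain ⟨l, hl⟩ := rinner_CLM ν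
  have hcomm : rinner ((r ^ 2)⁻¹ • ∫ y, φ (‖y‖ ^ 2 / r ^ 2) • G y ∂μ) ν
      = (r ^ 2)⁻¹ * ∫ y, φ (‖y‖ ^ 2 / r ^ 2) * rinner (G y) ν ∂μ := by
    rw [← hl, map_smul, ← l.integral_comp_comm hint]
    simp only [smul_eq_mul, hl, rinner_smul_left']
  have hint2 : Integrable (fun y : ℂ => φ (‖y‖ ^ 2 / r ^ 2) * rinner (G y) ν) μ := by
    have := l.integrable_comp hint
    simpa only [hl, rinner_smul_left'] using this
  rw [hcomm, abs_mul, abs_of_pos (inv_pos.2 hr2)]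
  have main : 1 / 2 * (μ A).toReal ≤ σ * ∫ y, φ (‖y‖ ^ 2 / r ^ 2) * rinner (G y) ν ∂μ := by
    rw [← integral_const_mul]
    have e : 1 / 2 * (μ A).toReal = ∫ y, A.indicator (fun _ => (1 / 2 : ℝ)) y ∂μ := by
      rw [integral_indicator hAm, setIntegral_const, smul_eq_mul, mul_comm]; rfl
    rw [e]
    apply integral_mono
    · exact (integrable_indicator_iff hAm).2 (integrableOn_const hAfin.ne)
    · exact hint2.const_mul σ
    · intro y
      show A.indicator (fun _ => (1 / 2 : ℝ)) y ≤ σ * (φ (‖y‖ ^ 2 / r ^ 2) * rinner (G y) ν)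
      by_cases hy : y ∈ A
      · rw [indicator_of_mem hy]
        have hy0 : y ≠ 0 := by
          rintro rfl
          have := hy.1
          rw [norm_zero] at this; linarith
        have hs : ‖y‖ ^ 2 ≤ 2 * r ^ 2 := by
          have := pow_le_pow_left₀ (norm_nonneg y) hy.2 2
          rwa [mul_pow, Real.sq_sqrt (by norm_num)] at this
        rw [hφ1 _ (by rw [le_div_iff₀ hr2]; nlinarith [hy.1]) (by rw [div_le_iff₀ hr2]; exact hs),
          one_mul]
        exact hGl y hy0
      · rw [indicator_of_notMem hy]
        by_cases hy0 : y = 0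
        · rw [hy0, hzero0]; simp
        · have := mul_nonneg (hφ (‖y‖ ^ 2 / r ^ 2)).1 (le_trans (by norm_num) (hGl y hy0))
          linarith
  have hle : σ * ∫ y, φ (‖y‖ ^ 2 / r ^ 2) * rinner (G y) ν ∂μ
      ≤ |∫ y, φ (‖y‖ ^ 2 / r ^ 2) * rinner (G y) ν ∂μ| := by
    rcases hσ with rfl | rfl
    · rw [one_mul]; exact le_abs_self _
    · rw [neg_one_mul]; exact neg_le_abs _
  calc _ = (r ^ 2)⁻¹ * (1 / 2 * (μ A).toReal) := by ring
    _ ≤ _ := mul_le_mul_of_nonneg_left (main.trans hle) (inv_pos.2 hr2).le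

lemma perp_unit (e ez : ℂ) (he : ‖e‖ = 1) (hez : ‖ez‖ = 1) (h : rinner ez e = 0) :
    ∃ τ : ℝ, (τ = 1 ∨ τ = -1) ∧ ez = τ • (Complex.I * e) := by
  have h1 : e.re ^ 2 + e.im ^ 2 = 1 := by
    have := Complex.sq_norm e
    rw [he, Complex.normSq_apply] at this; linarith
  have h2 : ez.re ^ 2 + ez.im ^ 2 = 1 := by
    have := Complex.sq_norm ez
    rw [hez, Complex.normSq_apply] at this; linarith
  unfold rinner at h
  refine ⟨ez.im * e.re - ez.re * e.im, ?_, ?_⟩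
  · apply sq_eq_one_iff.1
    linear_combination (ez.re ^ 2 + ez.im ^ 2) * h1 + h2 - (ez.re * e.re + ez.im * e.im) * h
  · apply Complex.ext
    · simp; linear_combination (-ez.re) * h1 + e.re * h
    · simp; linear_combination (-ez.im) * h1 + e.im * h

/-- Lower bound on the linearized term `A₂`: there is a constant
`c > 0` depending only on `δ_Ω` such that
`|⟨A₂(e_z), ν⟩| ≥ c r⁻² μ({r ≤ |y| ≤ √2 r})`. -/
theorem stmt_14 (δ : ℝ) (hδ0 : 0 ≤ δ) (hδ1 : δ ≤ 1 / 20) :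
    ∃ c : ℝ, 0 < c ∧
      ∀ Ω : ℂ → ℂ, MapsCircle Ω → OddOnCircle Ω → BiLipOnCircle Ω δ → CircleCk Ω 1 →
      ∀ μ : Measure ℂ, IsLocallyFiniteMeasure μ →
      ∀ φ : ℝ → ℝ, ContDiff ℝ (⊤ : ℕ∞) φ → (∀ t : ℝ, 0 ≤ φ t ∧ φ t ≤ 1) →
        (∀ t : ℝ, t < 1 / 4 ∨ 4 < t → φ t = 0) →
        (∀ t : ℝ, 1 ≤ t → t ≤ 2 → φ t = 1) →
      ∀ e ez : ℂ, ‖e‖ = 1 → ‖ez‖ = 1 → rinner ez e = 0 →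
      ∀ ν : ℂ, (ν = Complex.I * Ω e ∨ ν = -(Complex.I * Ω e)) →
      ∀ r : ℝ, 0 < r →
        c * (r ^ 2)⁻¹ * (μ {y : ℂ | r ≤ ‖y‖ ∧ ‖y‖ ≤ Real.sqrt 2 * r}).toReal ≤
          |rinner ((r ^ 2)⁻¹ •
            ∫ y, φ (‖y‖ ^ 2 / r ^ 2) • (fderiv ℝ (Kmap Ω) (-y)) ez ∂μ) ν| := by
  refine ⟨1 / 2, by norm_num, ?_⟩
  intro Ω _ _ hb hC μ hμ φ hφs hφ hφ0 hφ1 e ez he hez hperp ν hν r hr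
  obtain ⟨ω, hωC, hΩ⟩ := hC
  have hωC1 : ContDiff ℝ 1 ω := by simpa using hωC
  have hωd : Differentiable ℝ ω := hωC1.differentiable (by norm_num)
  have hωc : Continuous (deriv ω) := hωC1.continuous_deriv (by norm_num)
  have hdb := deriv_bounds δ hδ0 Ω hb ω hωd hΩ
  obtain ⟨σ, hσ, hσb⟩ := sign_bounds δ hδ0 hδ1 ω hωc hdb
  obtain ⟨τ, hτ, rfl⟩ := perp_unit e ez he hez hperp
  have hepolar : e = Complex.exp ((Complex.arg e : ℂ) * Complex.I) := by
    have := Complex.norm_mul_exp_arg_mul_I e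
    rw [he] at this
    simpa using this.symm
  set β := Complex.arg e
  have hΩe : Ω e = Complex.exp ((ω β : ℂ) * Complex.I) := by rw [hepolar, hΩ]
  obtain ⟨κ, hκ, hνκ⟩ : ∃ κ : ℝ, (κ = 1 ∨ κ = -1) ∧ ν = κ • (Complex.I * Ω e) := by
    rcases hν with h | h
    · exact ⟨1, Or.inl rfl, by simp [h]⟩
    · exact ⟨-1, Or.inr rfl, by simp [h]⟩
  apply integral_bound μ φ hφs.continuous hφ hφ0 hφ1 r hr
    (fun y => fderiv ℝ (Kmap Ω) (-y) (τ • (Complex.I * e))) _ _ ν (σ * τ * κ)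
  · rcases hσ with rfl | rfl <;> rcases hτ with rfl | rfl <;> rcases hκ with rfl | rfl <;> norm_num
  · intro y hy
    have hp := pointwise Ω ω hωd hΩ σ hσ hσb β (-y) (neg_ne_zero.2 hy)
    refine hp.trans (le_of_eq ?_)
    rw [map_smul, hνκ, hΩe, ← hepolar]
    have hτ2 : τ * τ = 1 := by rcases hτ with rfl | rfl <;> norm_num
    have hκ2 : κ * κ = 1 := by rcases hκ with rfl | rfl <;> norm_num
    have hbil : ∀ a b : ℂ, rinner (τ • a) (κ • b) = τ * κ * rinner a b := by
      intro a b; simp [rinner]; ring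
    rw [hbil]
    generalize rinner _ _ = q
    linear_combination (-(σ * q)) * hτ2 * (κ * κ) - σ * q * hκ2
  · exact (measurable_fderiv_apply_const ℝ (Kmap Ω) _).comp measurable_neg
  · intro y hy
    refine fderiv_bound Ω ω hωd hΩ (fun t => ?_) (-y) _ (neg_ne_zero.2 hy) hez
    linarith [(hdb t).2]
end
end

section
/- Suppose in addition that Ω is continuously differentiable, so that K is differentiable on ℂ∖{0}; denote by DK(y) its derivative at y. Let φ : [0,∞) → [0,1] be a smooth function with φ(t) = 0 for t ∉ [1/4, 4]. Let μ be a locally finite Borel measure on ℂ, let e ∈ 𝕊, let L = ℝe, let e_z ∈ 𝕊 satisfy ⟨e_z, e⟩ = 0, let ν = ±iΩ(e) be a unit normal to the line K(L) = ℝΩ(e), and for r > 0 define B(v) := r⁻⁴ ∫_ℂ K(−y) · φ′(|y|²/r²) · ⟨K(−y), DK(−y)·v⟩ dμ(y) for v ∈ ℂ. Then |⟨B(e_z), ν⟩| ≤ 2 · (sup |φ′|) · r⁻⁴ · ∫_{B(0,2r)} dist(y, L)² dμ(y). -/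
open MeasureTheory Metric Complex Filter Set
open scoped Topology ENNReal NNReal

noncomputable section

lemma aux_sin (δ c c' : ℝ) (hδ0 : 0 ≤ δ) (hδ1 : δ ≤ 1 / 20) (hc : 0 ≤ c)
    (h : Real.arccos c' ≤ (1 + δ) * Real.arccos c) :
    √(1 - c' ^ 2) ≤ 2 * √(1 - c ^ 2) := by
  rw [← Real.sin_arccos, ← Real.sin_arccos]
  have h0 := Real.arccos_nonneg c
  have h0' := Real.arccos_nonneg c'
  have h1 : Real.arccos c ≤ Real.pi / 2 := Real.arccos_le_pi_div_two.2 hc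
  set θ := Real.arccos c
  set α := Real.arccos c'
  have hpi := Real.pi_pos
  by_cases h6 : θ ≤ Real.pi / 6
  · have h2 : α ≤ 2 * θ := by nlinarith
    have h3 : Real.sin α ≤ Real.sin (2 * θ) :=
      Real.sin_le_sin_of_le_of_le_pi_div_two (by linarith) (by linarith) h2
    rw [Real.sin_two_mul] at h3
    have h4 : 0 ≤ Real.sin θ := Real.sin_nonneg_of_nonneg_of_le_pi h0 (by linarith)
    have h5 := Real.cos_le_one θ
    nlinarith
  · have h3 : Real.sin (Real.pi / 6) ≤ Real.sin θ :=
      Real.sin_le_sin_of_le_of_le_pi_div_two (by linarith) (by linarith) (by linarith)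
    rw [Real.sin_pi_div_six] at h3
    have := Real.sin_le_one α
    linarith

lemma norm_one_sq (u : ℂ) (hu : ‖u‖ = 1) : u.re ^ 2 + u.im ^ 2 = 1 := by
  have := Complex.sq_norm u
  rw [hu, Complex.normSq_apply] at this
  nlinarith

lemma rinner_perp_sq (a e f : ℂ) (ha : ‖a‖ = 1) (he : ‖e‖ = 1) (hf : ‖f‖ = 1)
    (h : rinner f e = 0) : rinner a f ^ 2 = 1 - rinner a e ^ 2 := by
  have ha := norm_one_sq a ha
  have he := norm_one_sq e he
  have hf := norm_one_sq f hf
  unfold rinner at *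
  obtain ⟨x, y⟩ := a
  obtain ⟨p, q⟩ := e
  obtain ⟨m, n⟩ := f
  simp only at *
  have hm : m = -q * (p * n - q * m) := by linear_combination -m * he + p * h
  have hn : n = p * (p * n - q * m) := by linear_combination -n * he + q * h
  have hd : (p * n - q * m) ^ 2 = 1 := by
    linear_combination (m^2+n^2) * he + hf - (m*p+n*q) * h
  generalize p * n - q * m = d at *
  subst hm hn
  linear_combination (-x * q + y * p)^2 * hd + (x^2+y^2) * he + ha

lemma abs_rinner_perp (a e f : ℂ) (ha : ‖a‖ = 1) (he : ‖e‖ = 1) (hf : ‖f‖ = 1)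
    (h : rinner f e = 0) : |rinner a f| = √(1 - rinner a e ^ 2) := by
  rw [← rinner_perp_sq a e f ha he hf h, Real.sqrt_sq_eq_abs]

lemma rinner_neg_left (a b : ℂ) : rinner (-a) b = -rinner a b := by
  simp [rinner]; ring

lemma rinner_ofReal_mul (t : ℝ) (a b : ℂ) : rinner ((t : ℂ) * a) b = t * rinner a b := by
  simp [rinner]; ring

lemma rinner_smul (t : ℝ) (a b : ℂ) : rinner (t • a) b = t * rinner a b := by
  simp [rinner]; ring

lemma abs_rinner_le (a b : ℂ) : |rinner a b| ≤ ‖a‖ * ‖b‖ := by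
  have h1 := Complex.sq_norm a
  have h2 := Complex.sq_norm b
  rw [Complex.normSq_apply] at h1 h2
  apply abs_le_of_sq_le_sq _ (by positivity)
  rw [mul_pow, h1, h2, rinner]
  nlinarith [sq_nonneg (a.re * b.im - a.im * b.re)]

lemma circle_bound (δ : ℝ) (hδ0 : 0 ≤ δ) (hδ1 : δ ≤ 1 / 20)
    (Ω : ℂ → ℂ) (hmap : MapsCircle Ω) (hodd : OddOnCircle Ω)
    (hbilip : BiLipOnCircle Ω δ) (e ez ν : ℂ) (he : ‖e‖ = 1) (hez : ‖ez‖ = 1)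
    (horth : rinner ez e = 0)
    (hν : ν = Complex.I * Ω e ∨ ν = -(Complex.I * Ω e)) (u : ℂ) (hu : ‖u‖ = 1) :
    |rinner (Ω u) ν| ≤ 2 * |rinner u ez| := by
  have hΩe := hmap e he
  have hν1 : ‖ν‖ = 1 := by rcases hν with h | h <;> simp [h, hΩe]
  have hν2 : rinner ν (Ω e) = 0 := by
    rcases hν with h | h <;> simp [h, rinner] <;> ring
  rw [abs_rinner_perp _ _ _ (hmap u hu) hΩe hν1 hν2, abs_rinner_perp _ _ _ hu he hez horth]
  rcases le_total 0 (rinner u e) with hc | hc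
  · exact aux_sin δ _ _ hδ0 hδ1 hc (hbilip u e hu he).2
  · have h := (hbilip (-u) e (by simpa using hu) he).2
    rw [hodd u hu] at h
    unfold dS at h
    rw [rinner_neg_left, rinner_neg_left] at h
    have := aux_sin δ _ _ hδ0 hδ1 (by linarith) h
    simpa using this

lemma norm_Kmap (Ω : ℂ → ℂ) (hmap : MapsCircle Ω) (x : ℂ) : ‖Kmap Ω x‖ = ‖x‖ := by
  by_cases hx : x = 0
  · simp [Kmap, hx]
  · have : ‖x / (‖x‖ : ℂ)‖ = 1 := by simp [hx]
    simp [Kmap, hmap _ this]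

lemma rinner_eq (a b : ℂ) : rinner a b = inner ℝ a b := by
  rw [Complex.inner]; simp [rinner]; try ring

lemma Kmap_bound (δ : ℝ) (hδ0 : 0 ≤ δ) (hδ1 : δ ≤ 1 / 20)
    (Ω : ℂ → ℂ) (hmap : MapsCircle Ω) (hodd : OddOnCircle Ω)
    (hbilip : BiLipOnCircle Ω δ) (e ez ν : ℂ) (he : ‖e‖ = 1) (hez : ‖ez‖ = 1)
    (horth : rinner ez e = 0)
    (hν : ν = Complex.I * Ω e ∨ ν = -(Complex.I * Ω e)) (x : ℂ) :
    |rinner (Kmap Ω x) ν| ≤ 2 * |rinner x ez| := by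
  by_cases hx : x = 0
  · simp [Kmap, hx, rinner]
  · have hu : ‖x / (‖x‖ : ℂ)‖ = 1 := by simp [hx]
    have h := circle_bound δ hδ0 hδ1 Ω hmap hodd hbilip e ez ν he hez horth hν _ hu
    have hx' : (‖x‖ : ℂ) ≠ 0 := by simpa using hx
    have e1 : rinner x ez = ‖x‖ * rinner (x / (‖x‖ : ℂ)) ez := by
      rw [← rinner_ofReal_mul, mul_div_cancel₀ _ hx']
    rw [e1, Kmap, rinner_ofReal_mul, abs_mul, abs_mul, abs_norm]
    nlinarith [norm_nonneg x]

lemma fderiv_bound_s15 (Ω : ℂ → ℂ) (hmap : MapsCircle Ω) (x v : ℂ) :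
    |rinner (Kmap Ω x) ((fderiv ℝ (Kmap Ω) x) v)| ≤ |rinner x v| := by
  by_cases hd : DifferentiableAt ℝ (Kmap Ω) x
  · have h1 := hd.hasFDerivAt.norm_sq
    have h2 := (hasFDerivAt_id (𝕜 := ℝ) x).norm_sq
    have h3 : (fun y => ‖Kmap Ω y‖ ^ 2) = fun y => ‖id y‖ ^ 2 := by
      funext y; simp [norm_Kmap Ω hmap]
    rw [h3] at h1
    have h4 := congrArg (fun A => A v) (h1.unique h2)
    simp only [ContinuousLinearMap.comp_apply, _root_.smul_apply, innerSL_apply_apply,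
      id, ContinuousLinearMap.id_apply] at h4
    rw [rinner_eq, rinner_eq]
    simp only [two_smul] at h4
    have : inner ℝ (Kmap Ω x) ((fderiv ℝ (Kmap Ω) x) v) = inner ℝ x v := by
      change inner ℝ (Kmap Ω x) ((fderiv ℝ (Kmap Ω) x) v) + inner ℝ (Kmap Ω x) ((fderiv ℝ (Kmap Ω) x) v) = inner ℝ x v + inner ℝ x v at h4
      linarith
    rw [this]
  · rw [fderiv_zero_of_not_differentiableAt hd]
    simp [rinner]

lemma dist_bound (e ez : ℂ) (hez : ‖ez‖ = 1) (horth : rinner ez e = 0) (y : ℂ) :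
    |rinner y ez| ≤ infDist y {z : ℂ | ∃ t : ℝ, z = t • e} := by
  have hne : ({z : ℂ | ∃ t : ℝ, z = t • e}).Nonempty := ⟨0, 0, by simp⟩
  apply (le_infDist hne).2
  rintro z ⟨t, rfl⟩
  have h : rinner y ez = rinner (y - t • e) ez := by
    simp only [rinner, Complex.sub_re, Complex.sub_im, Complex.real_smul, Complex.mul_re,
      Complex.mul_im, Complex.ofReal_re, Complex.ofReal_im] at *
    linear_combination t * horth
  rw [h, dist_eq_norm]
  simpa [hez] using abs_rinner_le (y - t • e) ez

lemma deriv_eq_zero_of_four_le (φ : ℝ → ℝ) (hφ : ContDiff ℝ (⊤ : ℕ∞) φ)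
    (hφ0 : ∀ t : ℝ, t < 1 / 4 ∨ 4 < t → φ t = 0) (t : ℝ) (ht : 4 ≤ t) : deriv φ t = 0 := by
  have hc : Continuous (deriv φ) := hφ.continuous_deriv (by norm_cast)
  have hcl : IsClosed {t | deriv φ t = 0} := isClosed_eq hc continuous_const
  have hsub : Ioi (4 : ℝ) ⊆ {t | deriv φ t = 0} := by
    intro s hs
    have : φ =ᶠ[𝓝 s] fun _ => 0 := by
      filter_upwards [Ioi_mem_nhds hs] with w hw
      exact hφ0 w (Or.inr hw)
    simp [this.deriv_eq]
  have := hcl.closure_subset_iff.2 hsub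
  rw [closure_Ioi] at this
  exact this ht

/-- Upper bound on the term `B_{1,2,1}` in terms of the squared
distance to the line `L = ℝe`. -/
theorem stmt_15 (δ : ℝ) (hδ0 : 0 ≤ δ) (hδ1 : δ ≤ 1 / 20)
    (Ω : ℂ → ℂ) (hmap : MapsCircle Ω) (hodd : OddOnCircle Ω)
    (hbilip : BiLipOnCircle Ω δ) (hC1 : CircleCk Ω 1)
    (μ : Measure ℂ) [IsLocallyFiniteMeasure μ]
    (φ : ℝ → ℝ) (hφ : ContDiff ℝ (⊤ : ℕ∞) φ) (hφ01 : ∀ t : ℝ, 0 ≤ φ t ∧ φ t ≤ 1)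
    (hφ0 : ∀ t : ℝ, t < 1 / 4 ∨ 4 < t → φ t = 0)
    (e ez : ℂ) (he : ‖e‖ = 1) (hez : ‖ez‖ = 1) (horth : rinner ez e = 0)
    (ν : ℂ) (hν : ν = Complex.I * Ω e ∨ ν = -(Complex.I * Ω e))
    (r : ℝ) (hr : 0 < r) (M : ℝ) (hM : ∀ t : ℝ, |deriv φ t| ≤ M) :
    |rinner ((r ^ 4)⁻¹ •
        ∫ y, (deriv φ (‖y‖ ^ 2 / r ^ 2) *
          rinner (Kmap Ω (-y)) ((fderiv ℝ (Kmap Ω) (-y)) ez)) • Kmap Ω (-y) ∂μ) ν| ≤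
      2 * M * (r ^ 4)⁻¹ *
        ∫ y in ball (0 : ℂ) (2 * r), (infDist y {z : ℂ | ∃ t : ℝ, z = t • e}) ^ 2 ∂μ := by
  set L : Set ℂ := {z : ℂ | ∃ t : ℝ, z = t • e} with hL
  set F : ℂ → ℂ := fun y => (deriv φ (‖y‖ ^ 2 / r ^ 2) *
          rinner (Kmap Ω (-y)) ((fderiv ℝ (Kmap Ω) (-y)) ez)) • Kmap Ω (-y) with hF
  have hM0 : 0 ≤ M := (abs_nonneg _).trans (hM 0)
  have hpt : ∀ y, ‖rinner (F y) ν‖ ≤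
      (ball (0 : ℂ) (2 * r)).indicator (fun y => 2 * M * (infDist y L) ^ 2) y := by
    intro y
    rw [Real.norm_eq_abs, hF]
    simp only
    rw [rinner_smul, abs_mul, abs_mul]
    by_cases hy : y ∈ ball (0 : ℂ) (2 * r)
    · rw [indicator_of_mem hy]
      have h1 := hM (‖y‖ ^ 2 / r ^ 2)
      have h2 := fderiv_bound_s15 Ω hmap (-y) ez
      have h3 := Kmap_bound δ hδ0 hδ1 Ω hmap hodd hbilip e ez ν he hez horth hν (-y)
      have h4 := dist_bound e ez hez horth y
      rw [rinner_neg_left, abs_neg] at h2 h3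
      have h5 := h2.trans h4
      have h6 : |rinner (Kmap Ω (-y)) ν| ≤ 2 * infDist y L := by linarith
      have h7 : 0 ≤ infDist y L := infDist_nonneg
      have h8 : 0 ≤ M * infDist y L := mul_nonneg hM0 h7
      calc _ ≤ M * infDist y L * (2 * infDist y L) := by gcongr
        _ = _ := by ring
    · rw [indicator_of_notMem hy]
      have hy' : 2 * r ≤ ‖y‖ := by simpa using hy
      have : 4 ≤ ‖y‖ ^ 2 / r ^ 2 := by
        rw [le_div_iff₀ (by positivity)]; nlinarith
      rw [deriv_eq_zero_of_four_le φ hφ hφ0 _ this]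
      simp
  have hint : Integrable
      ((ball (0 : ℂ) (2 * r)).indicator (fun y => 2 * M * (infDist y L) ^ 2)) μ := by
    rw [integrable_indicator_iff measurableSet_ball]
    have hc : Continuous (fun y : ℂ => 2 * M * (infDist y L) ^ 2) := by
      have := continuous_infDist_pt L
      fun_prop
    exact (hc.locallyIntegrable.integrableOn_isCompact
      (isCompact_closedBall (0 : ℂ) (2 * r))).mono_set ball_subset_closedBall
  have hmain : |rinner (∫ y, F y ∂μ) ν| ≤ 2 * M * ∫ y in ball (0 : ℂ) (2 * r), (infDist y L) ^ 2 ∂μ := by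
    by_cases hFi : Integrable F μ
    · have h1 : rinner (∫ y, F y ∂μ) ν = ∫ y, rinner (F y) ν ∂μ := by
        have := (innerSL ℝ ν).integral_comp_comm hFi
        simp only [innerSL_apply_apply] at this
        simp only [rinner_eq, real_inner_comm ν]
        exact this.symm
      rw [h1, ← Real.norm_eq_abs]
      refine (norm_integral_le_of_norm_le hint (Eventually.of_forall hpt)).trans ?_
      rw [integral_indicator measurableSet_ball, integral_const_mul]
    · rw [integral_undef hFi]
      have : 0 ≤ ∫ y in ball (0 : ℂ) (2 * r), (infDist y L) ^ 2 ∂μ :=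
        integral_nonneg fun y => sq_nonneg _
      simp only [rinner, Complex.zero_re, Complex.zero_im, zero_mul, add_zero, abs_zero]
      positivity
  rw [rinner_smul, abs_mul, abs_of_nonneg (by positivity : (0:ℝ) ≤ (r ^ 4)⁻¹)]
  calc _ ≤ (r ^ 4)⁻¹ * (2 * M * ∫ y in ball (0 : ℂ) (2 * r), (infDist y L) ^ 2 ∂μ) := by gcongr
    _ = _ := by ring
end
end

section
/- Suppose Ω : 𝕊 → 𝕊 is continuously differentiable and let ω : ℝ → ℝ be a continuously differentiable function with Ω(e^{it}) = e^{iω(t)} for all t ∈ ℝ. Then K(x) = |x| Ω(x/|x|) is differentiable at every y ∈ ℂ∖{0}, and writing ŷ = y/|y| = e^{it}, its derivative satisfies, for every v ∈ ℂ: DK(y)·v = ⟨ŷ, v⟩ Ω(ŷ) + ω′(t) ⟨v, iŷ⟩ iΩ(ŷ). (Here ⟨ŷ, v⟩ Ω(ŷ) is the radial part and ω′(t) ⟨v, iŷ⟩ iΩ(ŷ) the spherical part of the derivative.) -/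
open MeasureTheory Metric Complex Filter Set
open scoped Topology ENNReal NNReal

noncomputable section

/-- If `Ω` has a `C¹` lift `ω`, then `K` is differentiable away from
the origin, with `DK(y)·v = ⟨ŷ,v⟩ Ω(ŷ) + ω'(t) ⟨v, iŷ⟩ iΩ(ŷ)` where `ŷ = y/|y| = e^{it}`. -/
theorem stmt_16 (Ω : ℂ → ℂ) (hmap : MapsCircle Ω)
    (ω : ℝ → ℝ) (hω : ContDiff ℝ 1 ω)
    (hlift : ∀ t : ℝ, Ω (Complex.exp ((t : ℂ) * Complex.I)) =
      Complex.exp ((ω t : ℂ) * Complex.I)) :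
    ∀ y : ℂ, y ≠ 0 → ∀ t : ℝ, y / (‖y‖ : ℂ) = Complex.exp ((t : ℂ) * Complex.I) →
      ∃ D : ℂ →L[ℝ] ℂ, HasFDerivAt (Kmap Ω) D y ∧
        ∀ v : ℂ, D v =
          rinner (y / (‖y‖ : ℂ)) v • Ω (y / (‖y‖ : ℂ)) +
          (deriv ω t * rinner v (Complex.I * (y / (‖y‖ : ℂ)))) •
            (Complex.I * Ω (y / (‖y‖ : ℂ))) := by
  intro y hy t ht
  have hy' : (‖y‖ : ℂ) ≠ 0 := by simpa using hy
  have hE : Complex.exp ((t : ℂ) * Complex.I) ≠ 0 := Complex.exp_ne_zero _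
  set E : ℂ := Complex.exp ((t : ℂ) * Complex.I) with hEdef
  have hEn : ‖E‖ = 1 := Complex.norm_exp_ofReal_mul_I t
  have hyE : y / E = (‖y‖ : ℂ) := by
    rw [← ht]; field_simp
  have hslit : y / E ∈ Complex.slitPlane := by
    rw [hyE, Complex.ofReal_mem_slitPlane]; exact norm_pos_iff.mpr hy
  have hL : HasFDerivAt (fun x : ℂ => Complex.log (x / E))
      (((1 : ℂ →L[ℂ] ℂ).smulRight (y⁻¹)).restrictScalars ℝ) y := by
    have h1 : HasDerivAt (fun x : ℂ => Complex.log (x / E)) (y⁻¹) y := by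
      have h2 := ((hasDerivAt_id y).div_const E).clog hslit
      have h3 : y⁻¹ = 1 / E / (y / E) := by field_simp
      rw [h3]
      exact h2
    exact h1.hasFDerivAt.restrictScalars ℝ
  have him : Complex.log (y / E) = (Real.log ‖y‖ : ℂ) := by
    rw [hyE, Complex.ofReal_log (norm_nonneg y)]
  have hω' : HasDerivAt ω (deriv ω t) (t + (Complex.log (y / E)).im) := by
    rw [him, Complex.ofReal_im, add_zero]
    exact (hω.differentiable (by norm_num)).differentiableAt.hasDerivAt
  have hre := Complex.reCLM.hasFDerivAt.comp y hL
  have hIm := (Complex.imCLM.hasFDerivAt.comp y hL).const_add t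
  have hw := hω'.comp_hasFDerivAt y hIm
  have hF := ((Complex.ofRealCLM.hasFDerivAt.comp y hre).add
    ((Complex.ofRealCLM.hasFDerivAt.comp y hw).mul_const Complex.I)).cexp
  have hev : Kmap Ω =ᶠ[𝓝 y] fun x => Complex.exp (((Complex.log (x / E)).re : ℂ) +
      ((ω (t + (Complex.log (x / E)).im) : ℝ) : ℂ) * Complex.I) := by
    filter_upwards [isOpen_ne.mem_nhds hy] with x hx
    have hx' : (‖x‖ : ℂ) ≠ 0 := by simpa using hx
    have hre : Complex.exp (((Complex.log (x / E)).re : ℂ)) = (‖x‖ : ℂ) := by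
      rw [Complex.log_re, norm_div, hEn, div_one, ← Complex.ofReal_exp,
        Real.exp_log (norm_pos_iff.mpr hx)]
    have hdir : x / (‖x‖ : ℂ) =
        Complex.exp (((t + (Complex.log (x / E)).im : ℝ) : ℂ) * Complex.I) := by
      have h1 : Complex.exp (Complex.log (x / E)) = x / E :=
        Complex.exp_log (div_ne_zero hx hE)
      rw [← Complex.re_add_im (Complex.log (x / E)), Complex.exp_add, hre] at h1
      rw [Complex.ofReal_add, add_mul, Complex.exp_add, ← hEdef, div_eq_iff hx']
      field_simp at h1
      exact h1.symm.trans (by ring)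
    rw [Complex.exp_add, hre, ← hlift, ← hdir, Kmap]
  refine ⟨_, HasFDerivAt.congr_of_eventuallyEq hF hev, fun v => ?_⟩
  have hKy := hev.eq_of_nhds
  have hval : Complex.exp (((Complex.log (y / E)).re : ℂ) +
      ((ω (t + (Complex.log (y / E)).im) : ℝ) : ℂ) * Complex.I) = (‖y‖ : ℂ) * Ω E := by
    rw [← hKy, Kmap, ht]
  have hyy : y = (‖y‖ : ℂ) * E := by rw [← ht]; field_simp
  have hEinv : E⁻¹ = (starRingEnd ℂ) E := by
    rw [Complex.inv_def, Complex.normSq_eq_norm_sq, hEn]; simp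
  have hvy : (‖y‖ : ℂ) * (v * y⁻¹) = v * (starRingEnd ℂ) E := by
    rw [← hEinv]; nth_rewrite 2 [hyy]; field_simp
  have hr : rinner E v = ‖y‖ * (v * y⁻¹).re := by
    have := congrArg Complex.re hvy
    rw [Complex.re_ofReal_mul] at this
    rw [this]; simp [rinner] <;> ring
  have hi : rinner v (Complex.I * E) = ‖y‖ * (v * y⁻¹).im := by
    have := congrArg Complex.im hvy
    rw [Complex.im_ofReal_mul] at this
    rw [this]; simp [rinner] <;> ring
  rw [ht, hr, hi]
  simp only [Function.comp_apply, Pi.add_apply, Complex.reCLM_apply, Complex.ofRealCLM_apply, Complex.imCLM_apply,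
    smul_apply, add_apply, ContinuousLinearMap.comp_apply,
    ContinuousLinearMap.coe_restrictScalars', ContinuousLinearMap.smulRight_apply,
    one_apply_eq_self, smul_eq_mul, Complex.real_smul, hval]
  push_cast
  ring
end
end

section
/- Let μ be an Ahlfors 1-regular measure on ℂ with constant C₀, and let η ∈ (0,1) be such that for every x ∈ spt(μ) and t > 0 there exist two points of B(x,t) ∩ spt(μ) at mutual distance at least ηt. Then there exists c* > 0, depending only on C₀ and η, with the following property. Let x ∈ spt(μ), t > 0 and A ≥ 1, define β(y) := (∫_{At}^{2At} β_{μ,2}(y,s)² ds/s)^{1/2} for y ∈ ℂ, and let P be any affine line with ((1/(3t)) ∫_{B(x,3t)} (dist(y,P)/(3t))² dμ(y))^{1/2} ≤ 2 β_{μ,2}(x,3t). Then there exist x₀, x₁ ∈ B(x,t) ∩ spt(μ) such that |x₁ − x₀| ≥ ηt/2 and, for j = 0, 1: dist(x_j, P) ≤ c* β_{μ,2}(x,3t) · t and β(x_j)² ≤ c* μ(B(x,t))⁻¹ ∫_{B(x,t)} β(y)² dμ(y). -/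
open MeasureTheory Metric Complex Filter Set
open scoped Topology ENNReal NNReal

noncomputable section

/-- The Jones beta number `β_{μ,2}(x,t)`. -/
def beta2 (μ : Measure ℂ) (x : ℂ) (t : ℝ) : ℝ :=
  sInf {v : ℝ | ∃ P : Set ℂ, IsLine P ∧
    v = Real.sqrt (t⁻¹ * ∫ y in ball x t, (infDist y P / t) ^ 2 ∂μ)}

/-- Parameter space for lines. -/
abbrev LPar := ℂ × {b : ℂ // b ≠ 0}

/-- Distance to the line with parameter `p`. -/
def Gd (p : LPar) (z : ℂ) : ℝ :=
  |((z - p.1) * (starRingEnd ℂ) (p.2 : ℂ)).im| / ‖(p.2 : ℂ)‖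

lemma infDist_line (a b : ℂ) (hb : b ≠ 0) (z : ℂ) :
    infDist z {w : ℂ | ∃ t : ℝ, w = a + t • b} = Gd (a, ⟨b, hb⟩) z := by
  have hb' : 0 < ‖b‖ := norm_pos_iff.mpr hb
  have hne : {w : ℂ | ∃ t : ℝ, w = a + t • b}.Nonempty := ⟨a, 0, by simp⟩
  apply le_antisymm
  · set t : ℝ := ((z - a) * (starRingEnd ℂ) b).re / ‖b‖ ^ 2 with ht
    have hmem : a + t • b ∈ {w : ℂ | ∃ t : ℝ, w = a + t • b} := ⟨t, rfl⟩
    refine (infDist_le_dist_of_mem hmem).trans ?_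
    unfold Gd
    rw [le_div_iff₀ hb', dist_eq_norm]
    have h1 : (z - (a + t • b)) * (starRingEnd ℂ) b
        = (((z - a) * (starRingEnd ℂ) b).im : ℂ) * Complex.I := by
      have h2 : b * (starRingEnd ℂ) b = ((‖b‖ ^ 2 : ℝ) : ℂ) := by
        rw [Complex.mul_conj, Complex.normSq_eq_norm_sq]
      have h3 : (t : ℂ) * ((‖b‖ ^ 2 : ℝ) : ℂ) = (((z - a) * (starRingEnd ℂ) b).re : ℂ) := by
        rw [← Complex.ofReal_mul, ht, div_mul_cancel₀ _ (by positivity)]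
      have h4 := Complex.re_add_im ((z - a) * (starRingEnd ℂ) b)
      rw [Complex.real_smul]
      linear_combination -(t : ℂ) * h2 - h3 - h4
    have h5 := congrArg norm h1
    rw [norm_mul, norm_mul, Complex.norm_I, mul_one, RCLike.norm_conj, Complex.norm_real,
      Real.norm_eq_abs] at h5
    exact h5.le
  · rw [le_infDist hne]
    rintro w ⟨t, rfl⟩
    unfold Gd
    rw [div_le_iff₀ hb', dist_eq_norm]
    have h1 : ((z - a) * (starRingEnd ℂ) b).im = ((z - (a + t • b)) * (starRingEnd ℂ) b).im := by
      simp
      ring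
    have h2 : ‖(z - (a + t • b)) * (starRingEnd ℂ) b‖ = ‖z - (a + t • b)‖ * ‖b‖ := by
      rw [norm_mul, RCLike.norm_conj]
    simp only [h1]
    rw [← h2]
    exact Complex.abs_im_le_norm _

lemma Gd_nonneg (p : LPar) (z : ℂ) : 0 ≤ Gd p z := by unfold Gd; positivity

lemma Gd_le (p : LPar) (z : ℂ) : Gd p z ≤ ‖z - p.1‖ := by
  have hb' : 0 < ‖(p.2 : ℂ)‖ := norm_pos_iff.mpr p.2.2
  unfold Gd
  rw [div_le_iff₀ hb', ← RCLike.norm_conj (p.2 : ℂ), ← norm_mul]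
  exact Complex.abs_im_le_norm _

lemma Gd_cont (z : ℂ) : Continuous fun p : LPar => Gd p z := by
  unfold Gd
  refine Continuous.div ?_ (by fun_prop) (fun p => (norm_pos_iff.mpr p.2.2).ne')
  have : Continuous fun p : LPar => (p.2 : ℂ) := by fun_prop
  fun_prop

lemma Gd_cont' (p : LPar) : Continuous fun z => Gd p z := by
  unfold Gd
  fun_prop

lemma beta2_eq (μ : Measure ℂ) (x : ℂ) (t : ℝ) :
    beta2 μ x t = ⨅ p : LPar, Real.sqrt (t⁻¹ * ∫ y in ball x t, (Gd p y / t) ^ 2 ∂μ) := by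
  unfold beta2 iInf
  congr 1
  ext v
  constructor
  · rintro ⟨P, ⟨a, b, hb, rfl⟩, rfl⟩
    refine ⟨(a, ⟨b, hb⟩), ?_⟩
    simp only [infDist_line a b hb]
  · rintro ⟨⟨a, b, hb⟩, rfl⟩
    refine ⟨_, ⟨a, b, hb, rfl⟩, ?_⟩
    simp only [infDist_line a b hb]

lemma int_cont (μ : Measure ℂ) [IsLocallyFiniteMeasure μ] (x : ℂ) (t : ℝ) :
    Continuous fun p : LPar => ∫ y in ball x t, (Gd p y / t) ^ 2 ∂μ := by
  rw [continuous_iff_continuousAt]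
  intro p₀
  refine continuousAt_of_dominated (bound := fun _ => ((t + ‖x‖ + ‖p₀.1‖ + 1) / |t|) ^ 2) ?_ ?_ ?_ ?_
  · exact Eventually.of_forall fun p =>
      (((Gd_cont' p).div_const t).pow 2).aestronglyMeasurable
  · have hc : ContinuousAt (fun p : LPar => ‖p.1‖) p₀ := by fun_prop
    filter_upwards [hc.eventually_lt continuousAt_const (lt_add_one ‖p₀.1‖)] with p hp
    filter_upwards [ae_restrict_mem measurableSet_ball] with y hy
    rw [Real.norm_eq_abs, abs_pow, abs_div, abs_of_nonneg (Gd_nonneg p y)]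
    have h1 := Gd_le p y
    have h2 := norm_sub_le y p.1
    have h3 : ‖y‖ ≤ t + ‖x‖ := by
      have h4 : ‖y - x‖ < t := by simpa [dist_eq_norm] using hy
      have h5 := norm_sub_norm_le y x
      linarith
    gcongr
    · exact div_nonneg (Gd_nonneg p y) (abs_nonneg _)
    · linarith
  · have : IsFiniteMeasure (μ.restrict (ball x t)) := ⟨by simpa using measure_ball_lt_top⟩
    exact integrable_const _
  · exact Eventually.of_forall fun y => (((Gd_cont y).div_const t).pow 2).continuousAt

lemma bdd_range (μ : Measure ℂ) (x : ℂ) (t : ℝ) : BddBelow (range fun p : LPar =>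
    Real.sqrt (t⁻¹ * ∫ y in ball x t, (Gd p y / t) ^ 2 ∂μ)) :=
  ⟨0, by rintro _ ⟨p, rfl⟩; exact Real.sqrt_nonneg _⟩

lemma beta2_meas (μ : Measure ℂ) [IsLocallyFiniteMeasure μ] :
    Measurable fun q : ℂ × ℝ => beta2 μ q.1 q.2 := by
  have : Nonempty LPar := ⟨(0, ⟨1, one_ne_zero⟩)⟩
  obtain ⟨S, hSc, hSd⟩ := TopologicalSpace.exists_countable_dense LPar
  have := hSc.to_subtype
  have h : ∀ q : ℂ × ℝ, beta2 μ q.1 q.2 = ⨅ p : S,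
      Real.sqrt (q.2⁻¹ * ∫ y in ball q.1 q.2, (Gd p y / q.2) ^ 2 ∂μ) := by
    intro q
    rw [beta2_eq]
    symm
    refine Dense.ciInf hSd (f := fun p : LPar =>
      Real.sqrt (q.2⁻¹ * ∫ y in ball q.1 q.2, (Gd p y / q.2) ^ 2 ∂μ)) ?_ (bdd_range μ q.1 q.2)
    exact ((int_cont μ q.1 q.2).const_mul _).sqrt
  simp_rw [h]
  refine Measurable.iInf fun p => ?_
  refine Measurable.sqrt (Measurable.mul (by fun_prop) ?_)
  have h2 : ∀ q : ℂ × ℝ, ∫ y in ball q.1 q.2, (Gd p y / q.2) ^ 2 ∂μ =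
      ∫ y, {r : (ℂ × ℝ) × ℂ | dist r.2 r.1.1 < r.1.2}.indicator
        (fun r => (Gd p r.2 / r.1.2) ^ 2) (q, y) ∂μ := by
    intro q
    rw [← integral_indicator measurableSet_ball]
    rfl
  simp_rw [h2]
  refine (StronglyMeasurable.integral_prod_right' ?_).measurable
  refine Measurable.stronglyMeasurable (Measurable.indicator ?_ ?_)
  · have := (Gd_cont' p).measurable
    fun_prop
  · exact measurableSet_lt (by fun_prop) (by fun_prop)

lemma spt_null (μ : Measure ℂ) : μ (spt μ)ᶜ = 0 := by
  refine measure_null_of_locally_null _ fun x hx => ?_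
  simp only [spt, mem_compl_iff, mem_ofPred_eq, not_forall, not_lt, nonpos_iff_eq_zero] at hx
  obtain ⟨r, hr, h⟩ := hx
  exact ⟨ball x r, mem_nhdsWithin_of_mem_nhds (ball_mem_nhds x hr), h⟩

lemma cheb (μ : Measure ℂ) (S : Set ℂ) (hS : MeasurableSet S) (h0 : μ S ≠ 0) (h1 : μ S ≠ ∞) (f g : ℂ → ℝ)
    (hf : IntegrableOn f S μ) (hg : IntegrableOn g S μ) (hf0 : ∀ y, 0 ≤ f y) (hg0 : ∀ y, 0 ≤ g y)
    (p : ℂ → Prop) (hp : ∀ᵐ y ∂μ, p y) :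
    ∃ y ∈ S, p y ∧ f y ≤ 2 / (μ S).toReal * (∫ z in S, f z ∂μ) ∧
      g y ≤ 2 / (μ S).toReal * (∫ z in S, g z ∂μ) := by
  have key : ∀ f : ℂ → ℝ, IntegrableOn f S μ → (∀ y, 0 ≤ f y) →
      ∀ᵐ y ∂(μ.restrict S), (∫ z in S, f z ∂μ) = 0 → f y = 0 := by
    intro f hf hf0
    by_cases h : (∫ z in S, f z ∂μ) = 0
    · have := (integral_eq_zero_iff_of_nonneg (fun y => hf0 y) hf).mp h
      filter_upwards [this] with y hy _ using hy
    · exact Eventually.of_forall fun y hy => absurd hy h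
  have hall : ∀ᵐ y ∂(μ.restrict S), y ∈ S ∧ p y ∧ ((∫ z in S, f z ∂μ) = 0 → f y = 0) ∧
      ((∫ z in S, g z ∂μ) = 0 → g y = 0) := by
    filter_upwards [ae_restrict_mem hS, ae_restrict_of_ae hp, key f hf hf0, key g hg hg0]
      with y a b c d using ⟨a, b, c, d⟩
  set If := ∫ z in S, f z ∂μ with hIf
  set Ig := ∫ z in S, g z ∂μ with hIg
  have If0 : 0 ≤ If := integral_nonneg fun y => hf0 y
  have Ig0 : 0 ≤ Ig := integral_nonneg fun y => hg0 y
  have : IsFiniteMeasure (μ.restrict S) := ⟨by simpa using h1.lt_top⟩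
  obtain ⟨y, hyN, hy⟩ := exists_notMem_null_le_average (μ := μ.restrict S)
    (f := fun y => f y / If + g y / Ig) (by simpa [Measure.restrict_eq_zero] using h0)
    ((hf.div_const _).add (hg.div_const _)) hall
  obtain ⟨hyS, hpy, hfy, hgy⟩ := not_not.mp hyN
  have hm : 0 < (μ S).toReal := ENNReal.toReal_pos h0 h1
  have hav : (⨍ y, (f y / If + g y / Ig) ∂(μ.restrict S)) ≤ 2 / (μ S).toReal := by
    rw [average_eq, integral_add (hf.div_const _) (hg.div_const _), integral_div, integral_div,
      ← hIf, ← hIg, smul_eq_mul, div_eq_inv_mul 2]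
    have e : (μ.restrict S).real univ = (μ S).toReal := by simp [Measure.real]
    rw [e]
    have := div_self_le_one If
    have := div_self_le_one Ig
    gcongr
    linarith
  have hle := hy.trans hav
  have a1 : 0 ≤ f y / If := div_nonneg (hf0 y) If0
  have a2 : 0 ≤ g y / Ig := div_nonneg (hg0 y) Ig0
  refine ⟨y, hyS, hpy, ?_, ?_⟩
  · rcases If0.eq_or_lt with h | h
    · rw [hfy h.symm]; positivity
    · rw [← div_le_iff₀ h]; linarith
  · rcases Ig0.eq_or_lt with h | h
    · rw [hgy h.symm]; positivity
    · rw [← div_le_iff₀ h]; linarith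

lemma beta2_nonneg (μ : Measure ℂ) (x : ℂ) (t : ℝ) : 0 ≤ beta2 μ x t := by
  rw [beta2_eq]
  exact Real.iInf_nonneg fun p => Real.sqrt_nonneg _

lemma beta2_sq_le (μ : Measure ℂ) [IsLocallyFiniteMeasure μ] (y : ℂ) (s : ℝ) (hs : 0 < s) :
    beta2 μ y s ^ 2 ≤ s⁻¹ * (μ (ball y s)).toReal := by
  have h : beta2 μ y s ≤ Real.sqrt (s⁻¹ * (μ (ball y s)).toReal) := by
    rw [beta2_eq]
    refine (ciInf_le (bdd_range μ y s) (y, ⟨1, one_ne_zero⟩)).trans ?_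
    apply Real.sqrt_le_sqrt
    have := norm_setIntegral_le_of_norm_le_const (μ := μ) (s := ball y s) (C := 1)
      (f := fun z => (Gd (y, ⟨1, one_ne_zero⟩) z / s) ^ 2) measure_ball_lt_top ?_
    · have h2 := (le_abs_self _).trans this
      rw [one_mul] at h2
      exact mul_le_mul_of_nonneg_left h2 (by positivity)
    · intro z hz
      have h1 := Gd_le (y, ⟨1, one_ne_zero⟩) z
      have h0 := Gd_nonneg (y, ⟨1, one_ne_zero⟩) z
      have h2 : ‖z - y‖ < s := by simpa [dist_eq_norm] using hz
      rw [Real.norm_eq_abs, abs_of_nonneg (by positivity)]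
      refine pow_le_one₀ (by positivity) ?_
      rw [div_le_one hs]
      exact h1.trans h2.le
  calc beta2 μ y s ^ 2 ≤ Real.sqrt (s⁻¹ * (μ (ball y s)).toReal) ^ 2 := by
        have := beta2_nonneg μ y s
        gcongr
    _ = _ := Real.sq_sqrt (by positivity)

lemma g_int (μ : Measure ℂ) [IsLocallyFiniteMeasure μ] (x : ℂ) (t T : ℝ) (hT : 0 < T) :
    IntegrableOn (fun y => (Real.sqrt (∫ s in Set.Ioc T (2 * T), (beta2 μ y s) ^ 2 / s)) ^ 2)
      (ball x t) μ := by
  have hm : Measurable fun y =>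
      (Real.sqrt (∫ s in Set.Ioc T (2 * T), (beta2 μ y s) ^ 2 / s)) ^ 2 := by
    refine (Measurable.sqrt ?_).pow_const 2
    have := beta2_meas μ
    have h3 : Measurable fun q : ℂ × ℝ => (beta2 μ q.1 q.2) ^ 2 / q.2 := by fun_prop
    exact (h3.stronglyMeasurable.integral_prod_right'
      (ν := volume.restrict (Set.Ioc T (2 * T)))).measurable
  refine Measure.integrableOn_of_bounded
    (M := T⁻¹ * (μ (ball x (2 * T + t))).toReal / T * volume.real (Set.Ioc T (2 * T)))
    measure_ball_lt_top.ne hm.aestronglyMeasurable ?_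
  filter_upwards [ae_restrict_mem measurableSet_ball] with y hy
  have hn : 0 ≤ ∫ s in Set.Ioc T (2 * T), (beta2 μ y s) ^ 2 / s :=
    setIntegral_nonneg measurableSet_Ioc fun s hs => div_nonneg (sq_nonneg _) (hT.trans hs.1).le
  rw [Real.sq_sqrt hn]
  refine norm_setIntegral_le_of_norm_le_const measure_Ioc_lt_top fun s hs => ?_
  have hs0 : 0 < s := hT.trans hs.1
  rw [Real.norm_eq_abs, abs_of_nonneg (by positivity)]
  have h1 := beta2_sq_le μ y s hs0
  have h2 : (μ (ball y s)).toReal ≤ (μ (ball x (2 * T + t))).toReal := by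
    apply ENNReal.toReal_mono measure_ball_lt_top.ne
    apply measure_mono
    apply ball_subset_ball'
    have := mem_ball.mp hy
    linarith [hs.2]
  have h4 := hs.1.le
  calc beta2 μ y s ^ 2 / s ≤ s⁻¹ * (μ (ball y s)).toReal / s := by gcongr
    _ ≤ _ := by gcongr

lemma main_pick (C₀ : ℝ) (hC₀ : 0 < C₀) (ε : ℝ) (hε : 0 < ε)
    (μ : Measure ℂ) [IsLocallyFiniteMeasure μ] (hA : Ahlfors1 μ C₀) (x : ℂ) (hx : x ∈ spt μ)
    (t : ℝ) (ht : 0 < t) (T : ℝ) (hT : 0 < T) (P : Set ℂ)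
    (hP : Real.sqrt ((3 * t)⁻¹ * ∫ y in ball x (3 * t), (infDist y P / (3 * t)) ^ 2 ∂μ) ≤
          2 * beta2 μ x (3 * t))
    (a : ℂ) (ha : a ∈ spt μ) (hax : dist a x + ε * t ≤ t) :
    ∃ y ∈ ball a (ε * t), y ∈ spt μ ∧
      infDist y P ≤ (216 * C₀ / ε + 1 + 2 * C₀ ^ 2 / ε) * beta2 μ x (3 * t) * t ∧
      (Real.sqrt (∫ s in Set.Ioc T (2 * T), (beta2 μ y s) ^ 2 / s)) ^ 2 ≤
        (216 * C₀ / ε + 1 + 2 * C₀ ^ 2 / ε) * ((μ (ball x t)).toReal)⁻¹ *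
          ∫ y in ball x t, (Real.sqrt (∫ s in Set.Ioc T (2 * T), (beta2 μ y s) ^ 2 / s)) ^ 2 ∂μ := by
  set g : ℂ → ℝ := fun y => (Real.sqrt (∫ s in Set.Ioc T (2 * T), (beta2 μ y s) ^ 2 / s)) ^ 2
    with hg
  set f : ℂ → ℝ := fun y => (infDist y P / (3 * t)) ^ 2 with hf
  set b := beta2 μ x (3 * t) with hb
  have hb0 : 0 ≤ b := beta2_nonneg _ _ _
  have hf0 : ∀ y, 0 ≤ f y := fun y => sq_nonneg _
  have hg0 : ∀ y, 0 ≤ g y := fun y => sq_nonneg _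
  have hsub1 : ball a (ε * t) ⊆ ball x t := ball_subset_ball' (by linarith)
  have hsub3 : ball a (ε * t) ⊆ ball x (3 * t) :=
    hsub1.trans (ball_subset_ball (by linarith))
  have hgi : IntegrableOn g (ball x t) μ := g_int μ x t T hT
  have hfi : IntegrableOn f (ball x (3 * t)) μ := by
    have hc : Continuous f := ((continuous_infDist_pt P).div_const _).pow 2
    exact (hc.continuousOn.integrableOn_compact (isCompact_closedBall x (3 * t))).mono_set
      ball_subset_closedBall
  have hεt : 0 < ε * t := by positivity
  have hm0 : μ (ball a (ε * t)) ≠ 0 := (ha _ hεt).ne'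
  have hm1 : μ (ball a (ε * t)) ≠ ∞ := measure_ball_lt_top.ne
  obtain ⟨y, hyB, hys, hfy, hgy⟩ := cheb μ (ball a (ε * t)) measurableSet_ball hm0 hm1 f g
    (hfi.mono_set hsub3) (hgi.mono_set hsub1) hf0 hg0 (fun y => y ∈ spt μ)
    (mem_ae_iff.mpr (spt_null μ))
  have hIf : ∫ z in ball a (ε * t), f z ∂μ ≤ ∫ z in ball x (3 * t), f z ∂μ :=
    setIntegral_mono_set hfi (Eventually.of_forall hf0) hsub3.eventuallyLE
  have hIg : ∫ z in ball a (ε * t), g z ∂μ ≤ ∫ z in ball x t, g z ∂μ :=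
    setIntegral_mono_set hgi (Eventually.of_forall hg0) hsub1.eventuallyLE
  have hI0 : 0 ≤ ∫ z in ball x (3 * t), f z ∂μ := integral_nonneg hf0
  have hJ0 : 0 ≤ ∫ z in ball x t, g z ∂μ := integral_nonneg hg0
  have hm : C₀⁻¹ * (ε * t) ≤ (μ (ball a (ε * t))).toReal :=
    (ENNReal.ofReal_le_iff_le_toReal hm1).mp (hA a ha _ hεt).1
  have hM : (μ (ball x t)).toReal ≤ C₀ * t :=
    ENNReal.toReal_le_of_le_ofReal (by positivity) (hA x hx _ ht).2
  have hM0 : 0 < (μ (ball x t)).toReal := ENNReal.toReal_pos (hx _ ht).ne' measure_ball_lt_top.ne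
  have hc : 2 / (μ (ball a (ε * t))).toReal ≤ 2 * C₀ / (ε * t) := by
    have : 2 * C₀ / (ε * t) = 2 / (C₀⁻¹ * (ε * t)) := by field_simp
    rw [this]
    gcongr
  have hIb : ∫ z in ball x (3 * t), f z ∂μ ≤ 12 * t * b ^ 2 := by
    rw [Real.sqrt_le_left (by positivity), inv_mul_le_iff₀ (by positivity)] at hP
    linarith
  have hf2 : f y ≤ 24 * C₀ / ε * b ^ 2 := by
    calc f y ≤ 2 / (μ (ball a (ε * t))).toReal * (∫ z in ball a (ε * t), f z ∂μ) := hfy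
      _ ≤ 2 / (μ (ball a (ε * t))).toReal * (12 * t * b ^ 2) := by
        have := hIf.trans hIb
        gcongr
      _ ≤ 2 * C₀ / (ε * t) * (12 * t * b ^ 2) := by gcongr
      _ = _ := by field_simp; ring
  have hg2 : g y ≤ 2 * C₀ ^ 2 / ε * ((μ (ball x t)).toReal)⁻¹ * ∫ z in ball x t, g z ∂μ := by
    calc g y ≤ 2 / (μ (ball a (ε * t))).toReal * (∫ z in ball a (ε * t), g z ∂μ) := hgy
      _ ≤ 2 / (μ (ball a (ε * t))).toReal * (∫ z in ball x t, g z ∂μ) := by gcongr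
      _ ≤ 2 * C₀ / (ε * t) * (∫ z in ball x t, g z ∂μ) := by gcongr
      _ = 2 * C₀ ^ 2 / ε * (C₀ * t)⁻¹ * (∫ z in ball x t, g z ∂μ) := by field_simp
      _ ≤ _ := by gcongr
  have hK : 0 ≤ 216 * C₀ / ε := by positivity
  have hL : 0 ≤ 2 * C₀ ^ 2 / ε := by positivity
  refine ⟨y, hyB, hys, ?_, ?_⟩
  · have h1 : infDist y P ^ 2 ≤ 216 * C₀ / ε * (b * t) ^ 2 := by
      have e : infDist y P ^ 2 = 9 * t ^ 2 * f y := by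
        simp only [hf]; field_simp; ring
      rw [e]
      calc 9 * t ^ 2 * f y ≤ 9 * t ^ 2 * (24 * C₀ / ε * b ^ 2) := by gcongr
        _ = _ := by ring
    have h2 : infDist y P ≤ (216 * C₀ / ε + 1) * (b * t) := by
      apply le_of_sq_le_sq ?_ (by positivity)
      refine h1.trans ?_
      rw [mul_pow (216 * C₀ / ε + 1)]
      exact mul_le_mul_of_nonneg_right (by nlinarith) (sq_nonneg _)
    calc infDist y P ≤ (216 * C₀ / ε + 1) * (b * t) := h2
      _ ≤ (216 * C₀ / ε + 1 + 2 * C₀ ^ 2 / ε) * (b * t) :=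
          mul_le_mul_of_nonneg_right (by linarith) (by positivity)
      _ = _ := by ring
  · refine hg2.trans ?_
    gcongr
    linarith

/-- Choice of balanced points close to a best approximating line and
with controlled beta sums. -/
theorem stmt_18 (C₀ : ℝ) (hC₀ : 0 < C₀) (η : ℝ) (hη0 : 0 < η) (hη1 : η < 1) :
    ∃ cstar : ℝ, 0 < cstar ∧
      ∀ μ : Measure ℂ, IsLocallyFiniteMeasure μ → Ahlfors1 μ C₀ →
      (∀ x ∈ spt μ, ∀ t : ℝ, 0 < t →
        ∃ a b : ℂ, a ∈ ball x t ∩ spt μ ∧ b ∈ ball x t ∩ spt μ ∧ η * t ≤ dist a b) →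
      ∀ x ∈ spt μ, ∀ t : ℝ, 0 < t → ∀ A : ℝ, 1 ≤ A →
      ∀ P : Set ℂ, IsLine P →
        Real.sqrt ((3 * t)⁻¹ *
            ∫ y in ball x (3 * t), (infDist y P / (3 * t)) ^ 2 ∂μ) ≤
          2 * beta2 μ x (3 * t) →
      ∃ x₀ x₁ : ℂ, x₀ ∈ ball x t ∩ spt μ ∧ x₁ ∈ ball x t ∩ spt μ ∧
        η * t / 2 ≤ dist x₁ x₀ ∧
        ∀ xj ∈ ({x₀, x₁} : Set ℂ),
          infDist xj P ≤ cstar * beta2 μ x (3 * t) * t ∧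
          (Real.sqrt (∫ s in Set.Ioc (A * t) (2 * (A * t)),
              (beta2 μ xj s) ^ 2 / s)) ^ 2 ≤
            cstar * ((μ (ball x t)).toReal)⁻¹ *
              ∫ y in ball x t,
                (Real.sqrt (∫ s in Set.Ioc (A * t) (2 * (A * t)),
                  (beta2 μ y s) ^ 2 / s)) ^ 2 ∂μ := by
  have hε : 0 < η / 6 := by positivity
  refine ⟨216 * C₀ / (η / 6) + 1 + 2 * C₀ ^ 2 / (η / 6), by positivity, ?_⟩
  intro μ hμ hA hsep x hx t ht A hAone P _ hP
  obtain ⟨a, b, ⟨hax, has⟩, ⟨hbx, hbs⟩, hab⟩ := hsep x hx ((1 - η / 6) * t) (by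
    apply mul_pos _ ht; linarith)
  have hT : 0 < A * t := by positivity
  obtain ⟨x₀, h0B, h0s, h0⟩ := main_pick C₀ hC₀ (η / 6) hε μ hA x hx t ht (A * t) hT P hP a has
    (by have := mem_ball.mp hax; linarith)
  obtain ⟨x₁, h1B, h1s, h1⟩ := main_pick C₀ hC₀ (η / 6) hε μ hA x hx t ht (A * t) hT P hP b hbs
    (by have := mem_ball.mp hbx; linarith)
  rw [mem_ball] at h0B h1B hax hbx
  refine ⟨x₀, x₁, ⟨?_, h0s⟩, ⟨?_, h1s⟩, ?_, ?_⟩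
  · rw [mem_ball]
    have := dist_triangle x₀ a x
    linarith
  · rw [mem_ball]
    have := dist_triangle x₁ b x
    linarith
  · have h2 := dist_triangle4 a x₀ x₁ b
    rw [dist_comm a x₀, dist_comm x₀ x₁] at h2
    have h3 : η * (η * t) ≤ 1 * (η * t) := by gcongr
    nlinarith
  · intro xj hxj
    rcases hxj with rfl | rfl
    · exact h0
    · exact h1
end
end
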